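/- Let p be an odd prime and φ = x² + t ∈ 𝔽_p[t][x] with adjusted post-critical orbit (cₙ) ⊂ 𝔽_p[t], cₙ = dₙyₙ² with dₙ squarefree. If n ≥ 3 and cₙ has no squarefree primitive prime divisor over 𝔽̄_p, then 2^{n−2} ≤ 8·(2^{⌊n/2⌋} − 1) + 144; consequently every element of the squarefree Zsigmondy set of φ mod p is at most 11. -/

import Mathlib

open Polynomial

/-- `cₘ` has no squarefree primitive prime divisor over `𝔽̄_p`: every irreducible
`g ∈ 𝔽̄_p[t]` dividing `cₘ` to odd multiplicity divides some `cᵢ` with `0 < i < m`. -/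
def NoSqfreePrimitivePrimeDivisor (p : ℕ) [Fact p.Prime]
    (c : ℕ → Polynomial (ZMod p)) (m : ℕ) : Prop :=
  ∀ g : Polynomial (AlgebraicClosure (ZMod p)), Irreducible g →
    g ∣ (c m).map (algebraMap (ZMod p) (AlgebraicClosure (ZMod p))) →
    (∃ j : ℕ, Odd j ∧ g ^ j ∣ (c m).map (algebraMap (ZMod p) (AlgebraicClosure (ZMod p))) ∧
      ¬ g ^ (j + 1) ∣ (c m).map (algebraMap (ZMod p) (AlgebraicClosure (ZMod p)))) →
    ∃ i, 0 < i ∧ i < m ∧ g ∣ (c i).map (algebraMap (ZMod p) (AlgebraicClosure (ZMod p)))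

/-- The critical orbit of `x ^ 2 + t` over a field. -/
noncomputable def critOrb (K : Type*) [Field K] (n : ℕ) : Polynomial K :=
  (fun y : Polynomial K => y ^ 2 + X)^[n] 0

lemma critOrb_succ (K : Type*) [Field K] (n : ℕ) :
    critOrb K (n + 1) = critOrb K n ^ 2 + X := by
  unfold critOrb
  rw [Function.iterate_succ_apply']

lemma critOrb_deg (K : Type*) [Field K] (n : ℕ) :
    (critOrb K (n + 1)).Monic ∧ (critOrb K (n + 1)).natDegree = 2 ^ n := by
  induction n with
  | zero =>
    have : critOrb K 1 = X := by simp [critOrb]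
    rw [this]; exact ⟨monic_X, by simp⟩
  | succ k ih =>
    obtain ⟨hm, hd⟩ := ih
    rw [critOrb_succ]
    have hd2 : (critOrb K (k + 1) ^ 2).natDegree = 2 ^ (k + 1) := by
      rw [hm.natDegree_pow, hd, pow_succ]; ring
    have h2 : 1 < 2 ^ (k + 1) := Nat.one_lt_two_pow (by omega)
    have hlt : (X : Polynomial K).natDegree < (critOrb K (k + 1) ^ 2).natDegree := by
      rw [hd2, natDegree_X]; exact h2
    refine ⟨(hm.pow 2).add_of_left (degree_lt_degree hlt), ?_⟩
    rw [natDegree_add_eq_left_of_natDegree_lt hlt, hd2]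

lemma critOrb_eval (K : Type*) [Field K] (n : ℕ) (r : K) :
    (critOrb K n).eval r = (fun z : K => z ^ 2 + r)^[n] 0 := by
  induction n with
  | zero => simp [critOrb]
  | succ k ih => rw [critOrb_succ, Function.iterate_succ_apply', ← ih]; simp

/-- A monic polynomial over an algebraically closed field is `d * y ^ 2`, `d` small. -/
lemma exists_sqfree_decomp {K : Type*} [Field K] [IsAlgClosed K] (P : Polynomial K)
    (hP : P.Monic) (S : Finset K)
    (hS : ∀ r, Odd (P.rootMultiplicity r) → r ∈ S) :
    ∃ d y : Polynomial K, P = d * y ^ 2 ∧ d.Monic ∧ y.Monic ∧ d.natDegree ≤ S.card := by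
  classical
  refine ⟨∏ r ∈ P.roots.toFinset, (X - C r) ^ (P.rootMultiplicity r % 2),
    ∏ r ∈ P.roots.toFinset, (X - C r) ^ (P.rootMultiplicity r / 2), ?_, ?_, ?_, ?_⟩
  · have h := (IsAlgClosed.splits P).eq_prod_roots_of_monic hP
    conv_lhs => rw [h]
    rw [← Finset.prod_pow, ← Finset.prod_mul_distrib, Finset.prod_multiset_map_count]
    refine Finset.prod_congr rfl fun r _ => ?_
    rw [count_roots, ← pow_mul, ← pow_add]
    congr 1; omega
  · exact monic_prod_of_monic _ _ fun r _ => (monic_X_sub_C r).pow _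
  · exact monic_prod_of_monic _ _ fun r _ => (monic_X_sub_C r).pow _
  · rw [natDegree_prod_of_monic _ _ fun r _ => (monic_X_sub_C r).pow _]
    calc _ = ∑ r ∈ P.roots.toFinset, (P.rootMultiplicity r % 2) := by
            refine Finset.sum_congr rfl fun r _ => ?_
            rw [(monic_X_sub_C r).natDegree_pow, natDegree_X_sub_C, mul_one]
      _ ≤ ∑ r ∈ P.roots.toFinset, (if r ∈ S then 1 else 0) := by
            refine Finset.sum_le_sum fun r _ => ?_
            split_ifs with h
            · omega
            · have : ¬ Odd (P.rootMultiplicity r) := fun h' => h (hS r h')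
              rw [Nat.not_odd_iff] at this; omega
      _ = (P.roots.toFinset.filter (· ∈ S)).card := by
            rw [Finset.card_filter]
      _ ≤ S.card := Finset.card_le_card fun r hr => (Finset.mem_filter.1 hr).2

/-- The main height bound. -/
lemma critOrb_height {K : Type*} [Field K] (n : ℕ) (hn : 11 ≤ n)
    (d y : Polynomial K) (hd : d.Monic) (hy : y.Monic)
    (h : critOrb K n = d * y ^ 2) (hdeg : d.natDegree + 1 ≤ 2 ^ (n / 2)) : False := by
  obtain ⟨m, rfl⟩ : ∃ m, n = m + 1 + 1 + 1 + 1 := ⟨n - 4, by omega⟩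
  obtain ⟨hPm, hPd⟩ := critOrb_deg K (m + 1 + 1 + 1)
  obtain ⟨ham, had⟩ := critOrb_deg K (m + 1 + 1)
  obtain ⟨hbm, hbd⟩ := critOrb_deg K (m + 1)
  obtain ⟨hcm, hcd⟩ := critOrb_deg K m
  have hP := critOrb_succ K (m + 1 + 1 + 1)
  have ha := critOrb_succ K (m + 1 + 1)
  have hb := critOrb_succ K (m + 1)
  generalize critOrb K (m + 1 + 1 + 1 + 1) = P at *
  generalize critOrb K (m + 1 + 1 + 1) = a at *
  generalize critOrb K (m + 1 + 1) = b at *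
  generalize critOrb K (m + 1) = c at *
  have hdeg' : d.natDegree + 1 ≤ 2 ^ m :=
    hdeg.trans (Nat.pow_le_pow_right (by norm_num) (by omega))
  have hm7 : 2 ^ 7 ≤ 2 ^ m := Nat.pow_le_pow_right (by norm_num) (by omega)
  have hP' : derivative P = 2 * a * derivative a + 1 := by
    rw [hP]; simp [sq]; ring
  have hP'' : derivative P = y * (derivative d * y + 2 * d * derivative y) := by
    rw [h]; simp [sq]; ring
  obtain ⟨q, hq⟩ : y ∣ a - 2 * X * derivative a := by
    refine ⟨a * (derivative d * y + 2 * d * derivative y) - 2 * (d * y) * derivative a, ?_⟩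
    have e1 : a - 2 * X * derivative a = a * derivative P - 2 * P * derivative a := by
      rw [hP', hP]; ring
    rw [e1, hP'', h]; ring
  have hdegP : 2 ^ (m + 3) = d.natDegree + 2 * y.natDegree := by
    rw [← hPd, h, hd.natDegree_mul (hy.pow 2), hy.natDegree_pow]
  have hqdeg : 2 * q.natDegree ≤ d.natDegree := by
    rcases eq_or_ne q 0 with rfl | hq0
    · simp
    have e1 : (a - 2 * X * derivative a).natDegree ≤ 2 ^ (m + 2) := by
      refine (natDegree_sub_le _ _).trans (max_le had.le ?_)
      have e2 : (2 * X : Polynomial K).natDegree ≤ 1 := by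
        compute_degree
      have e3 := natDegree_derivative_le a
      refine natDegree_mul_le.trans ?_
      have : 0 < 2 ^ (m + 2) := by positivity
      have : a.natDegree = 2 ^ (m + 2) := had
      omega
    rw [hq, hy.natDegree_mul' hq0] at e1
    have : 2 ^ (m + 3) = 2 * 2 ^ (m + 2) := by ring
    omega
  have hX : (X : Polynomial K) ≠ 0 := X_ne_zero
  have ha' : derivative a = 2 * b * derivative b + 1 := by rw [ha]; simp [sq]; ring
  have hb' : derivative b = 2 * c * derivative c + 1 := by rw [hb]; simp [sq]; ring
  set w := b - 4 * X * derivative b with hw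
  have hyq : y * q = b * w - X := by
    rw [← hq, ha', ha, hw]; ring
  have key : d * (b * w - X) ^ 2 = q ^ 2 * ((b ^ 2 + X) ^ 2 + X) := by
    rw [← hyq, ← ha, ← hP, h]; ring
  have hX1 : (X + 1 : Polynomial K).natDegree ≤ 1 := by
    rw [← C_1, natDegree_X_add_C]
  have hdvd : b ∣ X * (d * X - q ^ 2 * (X + 1)) := by
    refine ⟨q ^ 2 * (b ^ 3 + 2 * b * X) - d * (b * w ^ 2 - 2 * w * X), ?_⟩
    linear_combination key
  have hz : X * (d * X - q ^ 2 * (X + 1)) = 0 := by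
    refine eq_zero_of_dvd_of_natDegree_lt hdvd ?_
    rw [hbd]
    have f1 : (d * X).natDegree ≤ d.natDegree + 1 := by
      refine natDegree_mul_le.trans ?_
      simp
    have f2 : (q ^ 2 * (X + 1)).natDegree ≤ d.natDegree + 1 := by
      refine natDegree_mul_le.trans ?_
      have := natDegree_pow_le (p := q) (n := 2)
      omega
    have f3 := (natDegree_sub_le (d * X) (q ^ 2 * (X + 1))).trans (max_le f1 f2)
    refine lt_of_le_of_lt natDegree_mul_le ?_
    have f4 : 2 ^ (m + 1) = 2 * 2 ^ m := by ring
    rw [natDegree_X, f4]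
    omega
  have hz' : d * X = q ^ 2 * (X + 1) := by
    rcases mul_eq_zero.1 hz with h0 | h0
    · exact absurd h0 hX
    · exact sub_eq_zero.1 h0
  have hq0 : q ≠ 0 := by
    rintro rfl
    simp [hd.ne_zero] at hz'
  have hb0 : b ≠ 0 := hbm.ne_zero
  have key2 : (X + 1) * w * (b * w - 2 * X) = X * b * (b ^ 2 + 2 * X) := by
    have : q ^ 2 * b * ((X + 1) * w * (b * w - 2 * X) - X * b * (b ^ 2 + 2 * X)) = 0 := by
      linear_combination X * key - (b * w - X) ^ 2 * hz'
    rcases mul_eq_zero.1 this with h0 | h0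
    · exact absurd h0 (mul_ne_zero (pow_ne_zero _ hq0) hb0)
    · exact sub_eq_zero.1 h0
  have hfin : c ∣ X ^ 2 * (8 * X ^ 2 + 13 * X + 6) := by
    have hwc : ∃ u, w = c * u - 3 * X :=
      ⟨c - 8 * X * derivative c, by rw [hw, hb', hb]; ring⟩
    obtain ⟨u, hu⟩ := hwc
    rw [hu, hb] at key2
    rw [← Ideal.Quotient.eq_zero_iff_dvd]
    have k3 := congrArg (Ideal.Quotient.mk (Ideal.span {c})) key2
    have hc0 : Ideal.Quotient.mk (Ideal.span {c}) c = 0 := by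
      rw [Ideal.Quotient.eq_zero_iff_dvd]
    simp only [map_mul, map_add, map_sub, map_pow, hc0, map_one, map_ofNat] at k3 ⊢
    linear_combination k3
  have hfz : X ^ 2 * (8 * X ^ 2 + 13 * X + 6 : Polynomial K) = 0 := by
    refine eq_zero_of_dvd_of_natDegree_lt hfin ?_
    rw [hcd]
    have : (X ^ 2 * (8 * X ^ 2 + 13 * X + 6 : Polynomial K)).natDegree ≤ 4 := by
      compute_degree
    omega
  rcases mul_eq_zero.1 hfz with h0 | h0
  · exact pow_ne_zero _ hX h0
  · have h1 := congrArg (eval (-1)) h0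
    simp at h1
    norm_num at h1

lemma card_roots_union {K : Type*} [Field K] [DecidableEq K] (N : ℕ) :
    ((Finset.range N).biUnion fun i => (critOrb K (i + 1)).roots.toFinset).card + 1 ≤ 2 ^ N := by
  have h1 : ((Finset.range N).biUnion fun i => (critOrb K (i + 1)).roots.toFinset).card
      ≤ ∑ i ∈ Finset.range N, 2 ^ i := by
    refine Finset.card_biUnion_le.trans (Finset.sum_le_sum fun i _ => ?_)
    rw [← (critOrb_deg K i).2]
    exact (Multiset.toFinset_card_le _).trans (card_roots' _)
  have h3 := Nat.geomSum_eq (le_refl 2) N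
  have : 0 < 2 ^ N := by positivity
  simp only [Nat.add_one_sub_one, Nat.div_one] at h3
  omega

lemma core (p : ℕ) [Fact p.Prime]
    (c : ℕ → Polynomial (ZMod p))
    (hc1 : c 1 = X)
    (hcn : ∀ m, 2 ≤ m → c m = (fun y => y ^ 2 + X)^[m] 0)
    (n : ℕ) (hn : 11 ≤ n) (hno : NoSqfreePrimitivePrimeDivisor p c n) : False := by
  classical
  set K := AlgebraicClosure (ZMod p) with hK
  have hmap : ∀ i, 0 < i → (c i).map (algebraMap (ZMod p) K) = critOrb K i := by
    intro i hi
    have e : c i = critOrb (ZMod p) i := by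
      rcases Nat.lt_or_ge i 2 with h | h
      · obtain rfl : i = 1 := by omega
        rw [hc1]; simp [critOrb]
      · exact hcn i h
    rw [e]
    clear e hi
    induction i with
    | zero => simp [critOrb]
    | succ k ih => rw [critOrb_succ, critOrb_succ, ← ih]; simp
  obtain ⟨hPm, -⟩ := critOrb_deg K (n - 1)
  rw [Nat.sub_add_cancel (by omega)] at hPm
  obtain ⟨d, y, h, hd, hy, hdeg⟩ := exists_sqfree_decomp (critOrb K n) hPm
    ((Finset.range (n / 2)).biUnion fun i => (critOrb K (i + 1)).roots.toFinset) (by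
      intro r hr
      have hroot : (critOrb K n).eval r = 0 := by
        have : 0 < (critOrb K n).rootMultiplicity r := hr.pos
        exact (rootMultiplicity_pos hPm.ne_zero).1 this
      obtain ⟨i, hi0, hin, hgi⟩ := hno (X - C r) (irreducible_X_sub_C r)
        (by rw [hmap n (by omega), dvd_iff_isRoot]; exact hroot)
        ⟨_, hr, by rw [hmap n (by omega)]; exact pow_rootMultiplicity_dvd _ _, by
          rw [hmap n (by omega)]
          intro hdv
          have := (le_rootMultiplicity_iff hPm.ne_zero).2 hdv
          omega⟩
      rw [hmap i hi0, dvd_iff_isRoot, IsRoot, critOrb_eval] at hgi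
      rw [critOrb_eval] at hroot
      have p1 : Function.IsPeriodicPt (fun z : K => z ^ 2 + r) i 0 := hgi
      have p2 : Function.IsPeriodicPt (fun z : K => z ^ 2 + r) n 0 := hroot
      have p3 := p1.gcd p2
      have hg0 : 0 < Nat.gcd i n := Nat.gcd_pos_of_pos_left _ hi0
      have hgle : Nat.gcd i n ≤ i := Nat.gcd_le_left _ hi0
      obtain ⟨k, hk⟩ := Nat.gcd_dvd_right i n
      have hk2 : 2 ≤ k := by
        by_contra hlt
        have : k ≤ 1 := by omega
        have := Nat.mul_le_mul_left (Nat.gcd i n) this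
        omega
      have hgn : Nat.gcd i n ≤ n / 2 := by
        have := Nat.mul_le_mul_left (Nat.gcd i n) hk2
        omega
      simp only [Finset.mem_biUnion, Finset.mem_range, Multiset.mem_toFinset]
      refine ⟨Nat.gcd i n - 1, by omega, ?_⟩
      rw [mem_roots (critOrb_deg K _).1.ne_zero, Nat.sub_add_cancel hg0, IsRoot, critOrb_eval]
      exact p3)
  exact critOrb_height n hn d y hd hy h
    ((Nat.add_le_add_right hdeg 1).trans (card_roots_union (n / 2)))

/-- Let `p` be an odd prime and `φ = x² + t ∈ 𝔽_p[t][x]` with adjusted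
post-critical orbit `(cₙ) ⊂ 𝔽_p[t]`.  If `n ≥ 3` and `cₙ` has no squarefree primitive
prime divisor over `𝔽̄_p`, then `2^(n-2) ≤ 8·(2^⌊n/2⌋ - 1) + 144`; consequently every
element of the squarefree Zsigmondy set of `φ mod p` is at most `11`. -/
theorem stmt_16 (p : ℕ) [Fact p.Prime] (hodd : p ≠ 2)
    (c : ℕ → Polynomial (ZMod p))
    (hc1 : c 1 = X)
    (hcn : ∀ m, 2 ≤ m → c m = (fun y => y ^ 2 + X)^[m] 0) :
    (∀ n, 3 ≤ n → NoSqfreePrimitivePrimeDivisor p c n →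
      2 ^ (n - 2) ≤ 8 * (2 ^ (n / 2) - 1) + 144) ∧
    (∀ m, NoSqfreePrimitivePrimeDivisor p c m → m ≤ 11) := by
  refine ⟨fun n hn hno => ?_, fun m hno => ?_⟩
  · by_cases h : 11 ≤ n
    · exact (core p c hc1 hcn n h hno).elim
    · have : n ≤ 10 := by omega
      interval_cases n <;> norm_num
  · by_contra h
    exact core p c hc1 hcn m (by omega) hno
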